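/- arXiv:1406.2883 — 3 statements merged into one kernel-verified Lean document; each statement's English description precedes it below -/
import Mathlib

section
/- Let b_1, b_2, ... be a non-decreasing unbounded sequence of positive real numbers, let α_1, α_2, ... be non-negative real numbers, and let r > 0. If Σ_{k=1}^∞ α_k / b_k^r < ∞, then there exists a non-decreasing unbounded sequence β_1, β_2, ... of positive real numbers such that Σ_{k=1}^∞ α_k / β_k^r < ∞ and β_k / b_k → 0 as k → ∞. -/
open Filter Topology

/-- Dividing the terms of a convergent non-negative series by the square roots of its tails
preserves convergence. -/
theorem summable_div_sqrt_tail {a : ℕ → ℝ} (ha : ∀ k, 0 ≤ a k) (hs : Summable a) :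
    Summable fun k => a k / √(∑' i, a (i + k)) := by
  set v : ℕ → ℝ := fun k => ∑' i, a (i + k) with hv
  have hv0 (k : ℕ) : 0 ≤ v k := tsum_nonneg fun i => ha _
  have hstep (k : ℕ) : v k = a k + v (k + 1) := by
    have h := ((summable_nat_add_iff k).2 hs).tsum_eq_zero_add
    simpa [hv, add_assoc, add_comm, add_left_comm] using h
  have hterm (k : ℕ) : a k / √(v k) ≤ 2 * (√(v k) - √(v (k + 1))) := by
    have hle : √(v (k + 1)) ≤ √(v k) := Real.sqrt_le_sqrt (by linarith [hstep k, ha k])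
    rcases (Real.sqrt_nonneg (v k)).eq_or_lt with h | h
    · rw [← h] at hle ⊢
      simp only [div_zero]
      linarith [Real.sqrt_nonneg (v (k + 1)), hle]
    · rw [div_le_iff₀ h]
      nlinarith [Real.sq_sqrt (hv0 k), Real.sq_sqrt (hv0 (k + 1)), hstep k,
        sq_nonneg (√(v k) - √(v (k + 1)))]
  refine summable_of_sum_range_le (c := 2 * √(v 0))
    (fun k => div_nonneg (ha k) (Real.sqrt_nonneg _)) fun n => ?_
  calc ∑ k ∈ Finset.range n, a k / √(v k)
      ≤ ∑ k ∈ Finset.range n, 2 * (√(v k) - √(v (k + 1))) :=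
        Finset.sum_le_sum fun k _ => hterm k
    _ = 2 * (√(v 0) - √(v n)) := by rw [← Finset.mul_sum, Finset.sum_range_sub']
    _ ≤ 2 * √(v 0) := by linarith [Real.sqrt_nonneg (v n)]

/-- If `w` tends to zero and `b` is positive, non-decreasing and unbounded, then the running
maxima of `b * w` are negligible compared to `b`. -/
theorem tendsto_partialSups_mul_div {b w : ℕ → ℝ} (hbpos : ∀ k, 0 < b k) (hbmono : Monotone b)
    (hbunb : Tendsto b atTop atTop) (hwpos : ∀ k, 0 < w k) (hw : Tendsto w atTop (𝓝 0)) :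
    Tendsto (fun k => partialSups (fun j => b j * w j) k / b k) atTop (𝓝 0) := by
  set u : ℕ → ℝ := fun j => b j * w j with hu
  have hpos (k : ℕ) : 0 < partialSups u k :=
    (mul_pos (hbpos k) (hwpos k)).trans_le (le_partialSups u k)
  refine tendsto_order.2 ⟨fun c hc => .of_forall fun k => hc.trans (div_pos (hpos k) (hbpos k)),
    fun ε hε => ?_⟩
  obtain ⟨N, hN⟩ := eventually_atTop.1 (hw.eventually (gt_mem_nhds (half_pos hε)))
  filter_upwards [hbunb.eventually_ge_atTop (partialSups u N / (ε / 2))] with k hk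
  have hbound : partialSups u k ≤ ε / 2 * b k := by
    refine partialSups_le _ _ _ fun j hj => ?_
    rcases le_total j N with hjN | hjN
    · rw [div_le_iff₀ (half_pos hε)] at hk
      linarith [le_partialSups_of_le u hjN]
    · calc b j * w j ≤ b k * (ε / 2) :=
            mul_le_mul (hbmono hj) (hN j hjN).le (hwpos j).le (hbpos k).le
        _ = ε / 2 * b k := mul_comm _ _
  rw [div_lt_iff₀ (hbpos k)]
  nlinarith [hbpos k]

/-- Fazekas–Klesov: from a summability condition one can find a smaller
normalizing sequence retaining summability. -/
theorem exists_smaller_normalizing_sequence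
    (b : ℕ → ℝ) (α : ℕ → ℝ) (r : ℝ) (hr : 0 < r)
    (hbpos : ∀ k, 0 < b k) (hbmono : Monotone b)
    (hbunb : Tendsto b atTop atTop)
    (hα : ∀ k, 0 ≤ α k)
    (hsum : Summable (fun k => α k / b k ^ r)) :
    ∃ β : ℕ → ℝ, (∀ k, 0 < β k) ∧ Monotone β ∧
      Tendsto β atTop atTop ∧
      Summable (fun k => α k / β k ^ r) ∧
      Tendsto (fun k => β k / b k) atTop (𝓝 0) := by
  set a : ℕ → ℝ := fun k => α k / b k ^ r with ha_def
  have hbr (k : ℕ) : 0 < b k ^ r := Real.rpow_pos_of_pos (hbpos k) r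
  have ha (k : ℕ) : 0 ≤ a k := div_nonneg (hα k) (hbr k).le
  set v : ℕ → ℝ := fun k => ∑' i, a (i + k) with hv
  have hv0 (k : ℕ) : 0 ≤ v k := tsum_nonneg fun i => ha _
  have hav (k : ℕ) : a k ≤ v k := by
    simpa using ((summable_nat_add_iff k).2 hsum).le_tsum 0 fun i _ => ha _
  have hvlim : Tendsto v atTop (𝓝 0) := tendsto_sum_nat_add a
  set w : ℕ → ℝ := fun k => max (√(v k) ^ r⁻¹) (√(b k))⁻¹ with hw
  have hsb (k : ℕ) : 0 < √(b k) := Real.sqrt_pos.2 (hbpos k)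
  have hwpos (k : ℕ) : 0 < w k := (inv_pos.2 (hsb k)).trans_le (le_max_right _ _)
  have hsqrt : Tendsto (fun k => √(b k)) atTop atTop := Real.tendsto_sqrt_atTop.comp hbunb
  have hwlim : Tendsto w atTop (𝓝 0) := by
    have h₁ : Tendsto (fun k => √(v k) ^ r⁻¹) atTop (𝓝 0) := by
      have h := hvlim.sqrt.rpow_const (p := r⁻¹) (.inr (inv_pos.2 hr).le)
      simpa [Real.zero_rpow (inv_pos.2 hr).ne'] using h
    simpa using h₁.max hsqrt.inv_tendsto_atTop
  have hle (k : ℕ) : b k * w k ≤ partialSups (fun j => b j * w j) k :=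
    le_partialSups (fun j => b j * w j) k
  have hβpos (k : ℕ) : 0 < partialSups (fun j => b j * w j) k :=
    (mul_pos (hbpos k) (hwpos k)).trans_le (hle k)
  refine ⟨partialSups fun j => b j * w j, hβpos, (partialSups _).monotone, ?_, ?_,
    tendsto_partialSups_mul_div hbpos hbmono hbunb hwpos hwlim⟩
  · refine tendsto_atTop_mono (fun k => le_trans ?_ (hle k)) hsqrt
    calc √(b k) = b k * (√(b k))⁻¹ := by
          rw [← div_eq_mul_inv, Real.div_sqrt]
      _ ≤ b k * w k := mul_le_mul_of_nonneg_left (le_max_right _ _) (hbpos k).le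
  · refine (summable_div_sqrt_tail ha hsum).of_nonneg_of_le
      (fun k => div_nonneg (hα k) (Real.rpow_nonneg (hβpos k).le r)) fun k => ?_
    change _ ≤ α k / b k ^ r / √(v k)
    rcases (hv0 k).eq_or_lt with h | h
    · have h0 : α k / b k ^ r = 0 := le_antisymm (h ▸ hav k) (ha k)
      have hα0 : α k = 0 := (div_eq_zero_iff.1 h0).resolve_right (hbr k).ne'
      simp [hα0]
    · rw [div_div]
      refine div_le_div_of_nonneg_left (hα k) (mul_pos (hbr k) (Real.sqrt_pos.2 h)) ?_
      calc b k ^ r * √(v k) = (b k * √(v k) ^ r⁻¹) ^ r := by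
            rw [Real.mul_rpow (hbpos k).le (by positivity),
              Real.rpow_inv_rpow (Real.sqrt_nonneg _) hr.ne']
        _ ≤ (b k * w k) ^ r := by
            have := hbpos k
            exact Real.rpow_le_rpow (by positivity)
              (mul_le_mul_of_nonneg_left (le_max_left _ _) this.le) hr.le
        _ ≤ _ := Real.rpow_le_rpow (mul_pos (hbpos k) (hwpos k)).le (hle k) hr.le
end

section
/- Let b_1, b_2, ... be a non-decreasing unbounded sequence of positive real numbers, α_1, α_2, ... non-negative real numbers, r > 0, and suppose Σ_{l=1}^∞ α_l / b_l^r < ∞. Fix 0 < δ < 1 and set ν_k = Σ_{l=k}^∞ α_l / b_l^r and β_n = max_{1 ≤ k ≤ n} b_k ν_k^{δ/r}. Then β_n / b_n → 0 as n → ∞. -/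
open Filter Finset Topology

/-- If `b` is positive and non-decreasing on the positive integers and tends to infinity, and the
weights `w` tend to zero, then the running maxima of `b k * w k` are negligible against `b n`. -/
theorem tendsto_sup'_mul_div_zero {b w m : ℕ → ℝ}
    (hbpos : ∀ k, 1 ≤ k → 0 < b k) (hbmono : MonotoneOn b (Set.Ici 1))
    (hbunb : Tendsto b atTop atTop) (hw0 : ∀ k, 1 ≤ k → 0 ≤ w k)
    (hw : Tendsto w atTop (𝓝 0))
    (hm : ∀ n, ∀ hn : 1 ≤ n, m n = (Finset.Icc 1 n).sup'
      (Finset.nonempty_Icc.mpr hn) (fun k => b k * w k)) :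
    Tendsto (fun n => m n / b n) atTop (𝓝 0) := by
  have le_m : ∀ n k, 1 ≤ k → k ≤ n → b k * w k ≤ m n := fun n k hk hkn => by
    rw [hm n (hk.trans hkn)]
    exact Finset.le_sup' (fun k => b k * w k) (Finset.mem_Icc.mpr ⟨hk, hkn⟩)
  rw [Metric.tendsto_atTop']
  intro ε hε
  obtain ⟨N, hN⟩ := eventually_atTop.mp (hw.eventually_le_const (half_pos hε))
  have hlarge := hbunb.eventually_ge_atTop (m (N + 1) / (ε / 2))
  obtain ⟨M, hM⟩ := eventually_atTop.mp hlarge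
  refine ⟨max M 1, fun n hn => ?_⟩
  have hn1 : 1 ≤ n := (le_max_right M 1).trans hn.le
  have hbn := hbpos n hn1
  have hmn : m n ≤ ε / 2 * b n := by
    rw [hm n hn1]
    refine Finset.sup'_le _ _ fun k hk => ?_
    obtain ⟨hk1, hkn⟩ := Finset.mem_Icc.mp hk
    rcases le_total k (N + 1) with hkN | hkN
    · calc b k * w k ≤ m (N + 1) := le_m _ k hk1 hkN
        _ ≤ ε / 2 * b n :=
          (div_le_iff₀' (half_pos hε)).mp (hM n ((le_max_left M 1).trans hn.le))
    · calc b k * w k ≤ b n * (ε / 2) :=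
            mul_le_mul (hbmono hk1 hn1 hkn) (hN k (by omega)) (hw0 k hk1) hbn.le
        _ = ε / 2 * b n := mul_comm _ _
  have hm0 : 0 ≤ m n :=
    (mul_nonneg (hbpos 1 le_rfl).le (hw0 1 le_rfl)).trans (le_m n 1 le_rfl hn1)
  rw [Real.dist_0_eq_abs, abs_of_nonneg (div_nonneg hm0 hbn.le), div_lt_iff₀ hbn]
  nlinarith [mul_pos hε hbn]

/-- The normalizing sequence `β_n = max_{1 ≤ k ≤ n} b_k ν_k^{δ/r}` of Hu–Hu
satisfies `β_n / b_n → 0`. -/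
theorem hu_hu_beta_div_b_tendsto_zero
    (b : ℕ → ℝ) (α : ℕ → ℝ) (r δ : ℝ) (hr : 0 < r)
    (hδ0 : 0 < δ) (hδ1 : δ < 1)
    (hbpos : ∀ k, 1 ≤ k → 0 < b k)
    (hbmono : ∀ k, 1 ≤ k → b k ≤ b (k + 1))
    (hbunb : Tendsto b atTop atTop)
    (hα : ∀ l, 0 ≤ α l)
    (hsum : Summable (fun l => α (l + 1) / b (l + 1) ^ r))
    (ν β : ℕ → ℝ)
    (hν : ∀ k, ν k = ∑' l : ℕ, α (k + l) / b (k + l) ^ r)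
    (hβ : ∀ n, ∀ hn : 1 ≤ n, β n = (Finset.Icc 1 n).sup'
      (Finset.nonempty_Icc.mpr hn) (fun k => b k * ν k ^ (δ / r))) :
    Tendsto (fun n => β n / b n) atTop (𝓝 0) := by
  have hν0 : ∀ k, 1 ≤ k → 0 ≤ ν k := fun k hk => by
    rw [hν k]
    exact tsum_nonneg fun l =>
      div_nonneg (hα _) (Real.rpow_nonneg (hbpos _ (by omega)).le _)
  have hνlim : Tendsto ν atTop (𝓝 0) := by
    have htail := tendsto_sum_nat_add (fun l => α l / b l ^ r)
    refine htail.congr fun k => ?_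
    simp only [hν k, add_comm]
  have hexp : 0 < δ / r := div_pos hδ0 hr
  have hw : Tendsto (fun k => ν k ^ (δ / r)) atTop (𝓝 0) := by
    simpa [Real.zero_rpow hexp.ne'] using hνlim.rpow_const (Or.inr hexp.le)
  have hmono : MonotoneOn b (Set.Ici 1) := fun i hi j _ hij =>
    Nat.le_induction le_rfl (fun k hk ih => ih.trans (hbmono k (le_trans hi hk))) j hij
  exact tendsto_sup'_mul_div_zero hbpos hmono hbunb
    (fun k hk => Real.rpow_nonneg (hν0 k hk) _) hw hβ
end

section
/- Let φ be a positive-valued function on the positive half-line such that Σ_{n=1}^∞ φ(n)/n^2 < ∞ and such that for some c > 0, φ is non-decreasing on [c, ∞) with φ(x) → ∞ as x → ∞. Let c_1, c_2, ... be non-negative real numbers with c_n > 0 for infinitely many n, and set ν_n = Σ_{k=n}^∞ c_k. If Σ_{k=1}^∞ c_k < ∞, then Σ_{n=1}^∞ c_n φ(1/ν_n) < ∞. -/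
open Filter Topology

/-- The length of `(0, t) ∩ (1 / (m + 1), 1 / m)`. -/
noncomputable def reciprocalOverlap (m : ℕ) (t : ℝ) : ℝ :=
  min t (1 / (m : ℝ)) - min t (1 / ((m + 1 : ℕ) : ℝ))

theorem one_div_natCast_succ_le {m : ℕ} (hm : 1 ≤ m) :
    1 / ((m + 1 : ℕ) : ℝ) ≤ 1 / (m : ℝ) := by
  have : (0 : ℝ) < m := by exact_mod_cast hm
  apply one_div_le_one_div_of_le this
  push_cast
  linarith

theorem reciprocalOverlap_mono {m : ℕ} (hm : 1 ≤ m) : Monotone (reciprocalOverlap m) := by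
  intro s t hst
  have h := one_div_natCast_succ_le hm
  unfold reciprocalOverlap
  generalize 1 / ((m + 1 : ℕ) : ℝ) = B at *
  generalize 1 / (m : ℝ) = A at *
  simp only [min_def]
  split_ifs <;> linarith

theorem reciprocalOverlap_eq_zero {m : ℕ} (hm : 1 ≤ m) {t : ℝ}
    (ht : t ≤ 1 / ((m + 1 : ℕ) : ℝ)) : reciprocalOverlap m t = 0 := by
  have h := one_div_natCast_succ_le hm
  rw [reciprocalOverlap, min_eq_left ht, min_eq_left (ht.trans h), sub_self]

theorem reciprocalOverlap_nonneg {m : ℕ} (hm : 1 ≤ m) (t : ℝ) : 0 ≤ reciprocalOverlap m t :=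
  sub_nonneg.2 (min_le_min_left t (one_div_natCast_succ_le hm))

theorem reciprocalOverlap_le {m : ℕ} (hm : 1 ≤ m) (t : ℝ) :
    reciprocalOverlap m t ≤ 2 / ((m + 1 : ℕ) : ℝ) ^ 2 := by
  have h := one_div_natCast_succ_le hm
  have hm' : (1 : ℝ) ≤ m := by exact_mod_cast hm
  have hle : reciprocalOverlap m t ≤ 1 / (m : ℝ) - 1 / ((m + 1 : ℕ) : ℝ) := by
    unfold reciprocalOverlap
    generalize 1 / ((m + 1 : ℕ) : ℝ) = B at *
    generalize 1 / (m : ℝ) = A at *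
    simp only [min_def]
    split_ifs <;> linarith
  refine hle.trans ?_
  push_cast
  rw [div_sub_div _ _ (by positivity) (by positivity), div_le_div_iff₀ (by positivity)
    (by positivity)]
  nlinarith

theorem hasSum_reciprocalOverlap {N : ℕ} (hN : 1 ≤ N) {t : ℝ} (ht0 : 0 ≤ t)
    (ht : t ≤ 1 / (N : ℝ)) : HasSum (fun k => reciprocalOverlap (k + N) t) t := by
  rw [hasSum_iff_tendsto_nat_of_nonneg fun k => reciprocalOverlap_nonneg (by omega) t]
  have hsum : ∀ n, ∑ k ∈ Finset.range n, reciprocalOverlap (k + N) t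
      = t - min t (1 / ((n + N : ℕ) : ℝ)) := by
    intro n
    induction n with
    | zero => rw [Finset.sum_range_zero, zero_add, min_eq_left ht, sub_self]
    | succ n ih =>
      rw [Finset.sum_range_succ, ih, reciprocalOverlap, Nat.add_right_comm n N 1]
      ring
  simp only [hsum]
  have hlim : Tendsto (fun n : ℕ => 1 / ((n + N : ℕ) : ℝ)) atTop (𝓝 0) :=
    (tendsto_add_atTop_iff_nat (f := fun n : ℕ => 1 / (n : ℝ)) N).2
      tendsto_one_div_atTop_nhds_zero_nat
  simpa [min_eq_right ht0] using (tendsto_const_nhds (x := t)).sub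
    ((tendsto_const_nhds (x := t)).min hlim)

/-- A primitive-like function for `t ↦ φ (1 / t)` near `0`, obtained by replacing the integral
`∫₀ᵗ φ (1 / s) ds` by an upper sum over the intervals `(1 / (m + 1), 1 / m)`. -/
theorem exists_nonneg_mul_le_sub {φ : ℝ → ℝ} {c : ℝ}
    (hφpos : ∀ x : ℝ, 0 < x → 0 < φ x)
    (hφsum : Summable (fun n : ℕ => φ n / (n : ℝ) ^ 2))
    (hφmono : MonotoneOn φ (Set.Ici c)) :
    ∃ G : ℝ → ℝ, ∃ δ > 0, (∀ t, 0 ≤ G t) ∧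
      ∀ s t, 0 < s → s ≤ t → t ≤ δ → (t - s) * φ (1 / t) ≤ G t - G s := by
  obtain ⟨N, hN⟩ := exists_nat_ge (max c 1)
  have hN1 : 1 ≤ N := by exact_mod_cast (le_max_right c 1).trans hN
  have hN0 : (0 : ℝ) < N := by exact_mod_cast hN1
  have hφ0 : ∀ k : ℕ, 0 ≤ φ ((k + N + 1 : ℕ) : ℝ) := fun k => (hφpos _ (by positivity)).le
  have hnn : ∀ t k, 0 ≤ φ ((k + N + 1 : ℕ) : ℝ) * reciprocalOverlap (k + N) t := fun t k =>
    mul_nonneg (hφ0 k) (reciprocalOverlap_nonneg (by omega) t)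
  have hs : ∀ t, Summable fun k => φ ((k + N + 1 : ℕ) : ℝ) * reciprocalOverlap (k + N) t := by
    intro t
    refine Summable.of_nonneg_of_le (hnn t) (fun k => ?_)
      (((summable_nat_add_iff (N + 1)).2 hφsum).mul_left 2)
    refine (mul_le_mul_of_nonneg_left (reciprocalOverlap_le (by omega) t) (hφ0 k)).trans
      (le_of_eq ?_)
    rw [← add_assoc]
    ring
  refine ⟨fun t => ∑' k, φ ((k + N + 1 : ℕ) : ℝ) * reciprocalOverlap (k + N) t, 1 / N,
    by positivity, fun t => tsum_nonneg (hnn t), fun s t hs0 hst ht => ?_⟩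
  have ht0 := hs0.trans_le hst
  refine hasSum_le (fun k => ?_)
    (((hasSum_reciprocalOverlap hN1 ht0.le ht).sub
      (hasSum_reciprocalOverlap hN1 hs0.le (hst.trans ht))).mul_right (φ (1 / t)))
    ((hs t).hasSum.sub (hs s).hasSum)
  rw [← mul_sub, mul_comm]
  have hk : 1 ≤ k + N := by omega
  rcases le_total t (1 / ((k + N + 1 : ℕ) : ℝ)) with h | h
  · rw [reciprocalOverlap_eq_zero hk h, reciprocalOverlap_eq_zero hk (hst.trans h)]
    simp
  · refine mul_le_mul_of_nonneg_right ?_ (sub_nonneg.2 (reciprocalOverlap_mono hk hst))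
    have hNt : (N : ℝ) ≤ 1 / t := (le_one_div hN0 ht0).2 ht
    have hct : c ≤ 1 / t := ((le_max_left c 1).trans hN).trans hNt
    have htk : 1 / t ≤ ((k + N + 1 : ℕ) : ℝ) := (one_div_le (by positivity) ht0).1 h
    exact hφmono hct (hct.trans htk) htk

/-- Sung–Hu–Volodin's generalization of Dini's theorem: if
`∑ φ(n)/n² < ∞`, `φ` is positive, non-decreasing on `[c, ∞)` and tends to `∞`,
the non-negative numbers `a_n` are summable with `a_n > 0` for infinitely many
`n`, and `ν_n = ∑_{k=n}^∞ a_k`, then `∑ a_n φ(1/ν_n) < ∞`. -/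
theorem sung_hu_volodin_dini
    (φ : ℝ → ℝ) (c : ℝ) (hc : 0 < c)
    (hφpos : ∀ x : ℝ, 0 < x → 0 < φ x)
    (hφsum : Summable (fun n : ℕ => φ n / (n : ℝ) ^ 2))
    (hφmono : MonotoneOn φ (Set.Ici c))
    (hφtop : Tendsto φ atTop atTop)
    (a : ℕ → ℝ) (ν : ℕ → ℝ)
    (ha : ∀ n, 0 ≤ a n)
    (hainf : {n : ℕ | 0 < a n}.Infinite)
    (hasum : Summable a)
    (hν : ∀ n, ν n = ∑' k : ℕ, a (n + k)) :
    Summable (fun n => a n * φ (1 / ν n)) := by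
  obtain ⟨G, δ, hδ, hG0, hG⟩ := exists_nonneg_mul_le_sub hφpos hφsum hφmono
  have htail : ∀ n, Summable fun k => a (n + k) := fun n => by
    simpa only [add_comm] using (summable_nat_add_iff n).2 hasum
  have hνpos : ∀ n, 0 < ν n := by
    intro n
    obtain ⟨m, hm, hnm⟩ := hainf.exists_gt n
    rw [hν]
    refine (htail n).tsum_pos (fun k => ha _) (m - n) ?_
    rwa [Nat.add_sub_cancel' hnm.le]
  have hνsucc : ∀ n, ν n = a n + ν (n + 1) := by
    intro n
    rw [hν, hν, (htail n).tsum_eq_zero_add]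
    simp only [add_zero, add_assoc, add_comm 1]
  have hνlim : Tendsto ν atTop (𝓝 0) := by
    have h := tendsto_sum_nat_add a
    simpa only [add_comm, ← funext hν] using h
  obtain ⟨n₀, hn₀⟩ := eventually_atTop.1 (hνlim.eventually (ge_mem_nhds hδ))
  rw [← summable_nat_add_iff n₀]
  refine summable_of_sum_range_le (c := G (ν (0 + n₀))) (fun n => mul_nonneg (ha _)
    (hφpos _ (one_div_pos.2 (hνpos _))).le) (fun n => ?_)
  calc ∑ i ∈ Finset.range n, a (i + n₀) * φ (1 / ν (i + n₀))
      ≤ ∑ i ∈ Finset.range n, (G (ν (i + n₀)) - G (ν (i + 1 + n₀))) := by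
        refine Finset.sum_le_sum fun i _ => ?_
        have h := hνsucc (i + n₀)
        rw [Nat.add_right_comm] at h
        have h' := hG _ _ (hνpos (i + 1 + n₀)) (by linarith [ha (i + n₀)]) (hn₀ (i + n₀) (by omega))
        rwa [sub_eq_of_eq_add h] at h'
    _ = G (ν (0 + n₀)) - G (ν (n + n₀)) := Finset.sum_range_sub' (fun i => G (ν (i + n₀))) n
    _ ≤ G (ν (0 + n₀)) := sub_le_self _ (hG0 _)
end
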